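/- Let 0 < m < n, let u ∈ U_{(m)} be a comb superclass representative and let λ ∈ 𝔫_{(m)}* be a comb supercharacter representative. Then χ^λ(u) = χ^λ(1) · ∏_{k=2}^{n} ( χ^{λ[u,k]}(u[k]) / χ^{λ[u,k]}(1) ). -/

import Mathlib

open Matrix BigOperators
open scoped Classical

/-- `n × n` matrices over `F`. -/
abbrev Mat (n : ℕ) (F : Type*) := Matrix (Fin n) (Fin n) F

section Defs

variable {n : ℕ} {F : Type*} [Field F] [Fintype F]

/-- The pattern group `U_P` attached to a relation `P` on `{0,…,n-1}`:
unipotent upper-triangular matrices supported (off the diagonal) on positions `(i,j)` with `P i j`. -/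
def patGroup (P : Fin n → Fin n → Prop) : Set (Mat n F) :=
  {u | (∀ i, u i i = 1) ∧ ∀ i j, i ≠ j → ¬ P i j → u i j = 0}

/-- Truncation of a matrix to the positions allowed by `P` (used to identify a functional on
`𝔫_P` with the matrix of its coefficients on allowable positions). -/
noncomputable def truncP (P : Fin n → Fin n → Prop) (A : Mat n F) : Mat n F :=
  Matrix.of fun i j => if P i j then A i j else 0

/-- The left orbit `U_P λ` of the functional (identified with a matrix) `lam`:
`(aλ)(x) = λ(a⁻¹ x)`, whose coefficient matrix is the truncation of `(a⁻¹)ᵀ * λ`. -/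
noncomputable def dualLeftOrbit (P : Fin n → Fin n → Prop) (lam : Mat n F) : Set (Mat n F) :=
  {mu | ∃ a ∈ (patGroup P : Set (Mat n F)), mu = truncP P ((a⁻¹)ᵀ * lam)}

/-- The two-sided orbit `U_P λ U_P` of the functional `lam`: `(aλb)(x) = λ(a⁻¹ x b⁻¹)`,
whose coefficient matrix is the truncation of `(a⁻¹)ᵀ * λ * (b⁻¹)ᵀ`. -/
noncomputable def dualOrbit (P : Fin n → Fin n → Prop) (lam : Mat n F) : Set (Mat n F) :=
  {mu | ∃ a ∈ (patGroup P : Set (Mat n F)), ∃ b ∈ (patGroup P : Set (Mat n F)),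
    mu = truncP P ((a⁻¹)ᵀ * lam * (b⁻¹)ᵀ)}

/-- The two-sided superclass orbit `{a (v-1) b : a, b ∈ U_P}` attached to `v ∈ U_P`. -/
def classOrbit (P : Fin n → Fin n → Prop) (v : Mat n F) : Set (Mat n F) :=
  {x | ∃ a ∈ (patGroup P : Set (Mat n F)), ∃ b ∈ (patGroup P : Set (Mat n F)),
    x = a * (v - 1) * b}

/-- The pairing `λ(x) = Σ_{i,j} λ_{ij} x_{ij}` of a functional-matrix with a matrix. -/
def pairM (A B : Mat n F) : F := ∑ i, ∑ j, A i j * B i j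

/-- The supercharacter `χ^λ` of the pattern group `U_P` attached to the functional `lam`:
`χ^λ(u) = (|U_Pλ|/|U_PλU_P|) Σ_{μ ∈ U_PλU_P} θ(−μ(u−1))`. -/
noncomputable def superChar (P : Fin n → Fin n → Prop) (θ : AddChar F ℂ)
    (lam u : Mat n F) : ℂ :=
  ((dualLeftOrbit P lam).ncard : ℂ) / ((dualOrbit P lam).ncard : ℂ) *
    ∑ᶠ mu ∈ dualOrbit P lam, θ (- pairM mu (u - 1))

/-- The full order `i < j`, whose pattern group is `U_n`. -/
def Plt (n : ℕ) : Fin n → Fin n → Prop := fun i j => i < j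

/-- The poset `𝒫_(m)` (in 0-based indexing): `i < j`, except that row `0` (row `1` in 1-based
indexing) is only comparable to columns `j` with 1-based value `j+1 > m`.  Its pattern group is
the interpolating group `U_(m)`. -/
def Pm (n m : ℕ) : Fin n → Fin n → Prop := fun i j => i < j ∧ (i.val = 0 → m < j.val + 1)

/-- `𝒮_n(q)`: strictly upper-triangular matrices with at most one nonzero entry in each row
and each column. -/
def Sset (n : ℕ) (F : Type*) [Field F] : Set (Mat n F) :=
  {lam | (∀ i j : Fin n, ¬ i < j → lam i j = 0) ∧
    (∀ (i j j' : Fin n), lam i j ≠ 0 → lam i j' ≠ 0 → j = j') ∧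
    (∀ (i i' j : Fin n), lam i j ≠ 0 → lam i' j ≠ 0 → i = i')}

/-- Adjacency of two nonzero positions of `A` (they share a row or a column): the edges of
the graph `G_A`. -/
def adjRel (A : Mat n F) (p q : Fin n × Fin n) : Prop :=
  p ≠ q ∧ A p.1 p.2 ≠ 0 ∧ A q.1 q.2 ≠ 0 ∧ (p.1 = q.1 ∨ p.2 = q.2)

/-- The connected component of the position `p` in the graph `G_A`. -/
def compOf (A : Mat n F) (p : Fin n × Fin n) : Set (Fin n × Fin n) :=
  {q | Relation.ReflTransGen (adjRel A) p q}

/-- The set of connected components of the graph `G_A`. -/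
def comps (A : Mat n F) : Set (Set (Fin n × Fin n)) :=
  {S | ∃ p : Fin n × Fin n, A p.1 p.2 ≠ 0 ∧ S = compOf A p}

/-- The matrix agreeing with `A` on the positions of `S` and vanishing elsewhere. -/
noncomputable def restrictTo (S : Set (Fin n × Fin n)) (A : Mat n F) : Mat n F :=
  Matrix.of fun i j => if (i, j) ∈ S then A i j else 0

/-- At most one connected component of `G_A` has more than one vertex. -/
def AtMostOneBig (A : Mat n F) : Prop :=
  ∀ p q : Fin n × Fin n, A p.1 p.2 ≠ 0 → A q.1 q.2 ≠ 0 →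
    1 < (compOf A p).ncard → 1 < (compOf A q).ncard → compOf A p = compOf A q

end Defs

section Reps

variable {n : ℕ} {F : Type*} [Field F] [Fintype F]

/-- The vertex-set shape (in 1-based coordinates `(v.1.val + 1, v.2.val + 1)`) of the large
connected component of a comb superclass representative:
`{(1,k_1),…,(1,k_r)} ∪ {(i_1,k_1),…,(i_{r'},k_{r'})}` with
`1 ≤ i_{r'} < ⋯ < i_1 ≤ m < k_1 < ⋯ < k_r ≤ n` and `r' ∈ {r−1, r}`. -/
def CombClassComp (m : ℕ) (S : Set (Fin n × Fin n)) : Prop :=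
  ∃ r r' : ℕ, (r' = r ∨ r' + 1 = r) ∧ 1 ≤ r' ∧
    ∃ i k : ℕ → ℕ,
      (∀ d, 1 ≤ d → d < r' → i (d + 1) < i d) ∧ 1 ≤ i r' ∧ i 1 ≤ m ∧
      m < k 1 ∧ (∀ d, 1 ≤ d → d < r → k d < k (d + 1)) ∧ k r ≤ n ∧
      S = {v : Fin n × Fin n |
        (v.1.val + 1 = 1 ∧ ∃ d, 1 ≤ d ∧ d ≤ r ∧ v.2.val + 1 = k d) ∨
        (∃ d, 1 ≤ d ∧ d ≤ r' ∧ v.1.val + 1 = i d ∧ v.2.val + 1 = k d)}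

/-- `u ∈ U_(m)` is a comb superclass representative (the condition is on `A = u − 1`):
at most one connected component of `G_A` has more than one vertex, and any such component has
the comb shape. -/
def IsCombClassRep (m : ℕ) (A : Mat n F) : Prop :=
  AtMostOneBig A ∧
    ∀ p : Fin n × Fin n, A p.1 p.2 ≠ 0 → 1 < (compOf A p).ncard →
      CombClassComp m (compOf A p)

/-- The vertex-set shape of the large connected component of a path superclass representative:
`{(1,k_1)} ∪ {(i_d,k_d) : 1 ≤ d ≤ r−1} ∪ {(i_d,k_{d+1}) : 1 ≤ d ≤ r−1} ∪ E` with `E = ∅` or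
`E = {(i_r,k_r)}`, where `1 < i_{r'} < ⋯ < i_1 ≤ m < k_1 < ⋯ < k_r ≤ n`, and `r' = r` if
`E ≠ ∅`, `r' = r − 1` if `E = ∅` (`e : Bool` records whether `E ≠ ∅`). -/
def PathClassComp (m : ℕ) (S : Set (Fin n × Fin n)) : Prop :=
  ∃ (r : ℕ) (e : Bool) (i k : ℕ → ℕ),
    1 ≤ r ∧
    (∀ d, 1 ≤ d → d < (if e then r else r - 1) → i (d + 1) < i d) ∧
    1 < i (if e then r else r - 1) ∧ i 1 ≤ m ∧
    m < k 1 ∧ (∀ d, 1 ≤ d → d < r → k d < k (d + 1)) ∧ k r ≤ n ∧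
    S = {v : Fin n × Fin n |
      (v.1.val + 1 = 1 ∧ v.2.val + 1 = k 1) ∨
      (∃ d, 1 ≤ d ∧ d ≤ r - 1 ∧ v.1.val + 1 = i d ∧ v.2.val + 1 = k d) ∨
      (∃ d, 1 ≤ d ∧ d ≤ r - 1 ∧ v.1.val + 1 = i d ∧ v.2.val + 1 = k (d + 1)) ∨
      (e = true ∧ v.1.val + 1 = i r ∧ v.2.val + 1 = k r)}

/-- `u ∈ U_(m)` is a path superclass representative (the condition is on `A = u − 1`). -/
def IsPathClassRep (m : ℕ) (A : Mat n F) : Prop :=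
  AtMostOneBig A ∧
    ∀ p : Fin n × Fin n, A p.1 p.2 ≠ 0 → 1 < (compOf A p).ncard →
      PathClassComp m (compOf A p)

/-- The vertex-set shape of the large connected component of a comb supercharacter
representative: `{(1,k_1)} ∪ {(i_d,k_{d+1}) : 1 ≤ d ≤ r−1} ∪ {(i_d,k_1) : 1 ≤ d ≤ r'}` with
`n ≥ k_1 > k_2 > ⋯ > k_r > m ≥ i_{r'} > ⋯ > i_1 > 1` and `r' ∈ {r−1, r}`. -/
def CombCharComp (m : ℕ) (S : Set (Fin n × Fin n)) : Prop :=
  ∃ r r' : ℕ, (r' = r ∨ r' + 1 = r) ∧ 1 ≤ r' ∧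
    ∃ i k : ℕ → ℕ,
      (∀ d, 1 ≤ d → d < r → k (d + 1) < k d) ∧ m < k r ∧ k 1 ≤ n ∧
      (∀ d, 1 ≤ d → d < r' → i d < i (d + 1)) ∧ i r' ≤ m ∧ 1 < i 1 ∧
      S = {v : Fin n × Fin n |
        (v.1.val + 1 = 1 ∧ v.2.val + 1 = k 1) ∨
        (∃ d, 1 ≤ d ∧ d ≤ r - 1 ∧ v.1.val + 1 = i d ∧ v.2.val + 1 = k (d + 1)) ∨
        (∃ d, 1 ≤ d ∧ d ≤ r' ∧ v.1.val + 1 = i d ∧ v.2.val + 1 = k 1)}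

/-- `λ ∈ 𝔫_(m)^*` is a comb supercharacter representative. -/
def IsCombCharRep (m : ℕ) (A : Mat n F) : Prop :=
  AtMostOneBig A ∧
    ∀ p : Fin n × Fin n, A p.1 p.2 ≠ 0 → 1 < (compOf A p).ncard →
      CombCharComp m (compOf A p)

/-- The vertex-set shape of the large connected component of a path supercharacter
representative: `{(1,k_1)} ∪ {(i_d,k_d) : 1 ≤ d ≤ r−1} ∪ {(i_d,k_{d+1}) : 1 ≤ d ≤ r−1} ∪ E`
with `E = ∅` or `E = {(i_r,k_r)}`, where `n ≥ k_1 > ⋯ > k_r > m ≥ i_{r'} > ⋯ > i_1 > 1`, and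
`r' = r` if `E ≠ ∅`, `r' = r − 1` if `E = ∅`. -/
def PathCharComp (m : ℕ) (S : Set (Fin n × Fin n)) : Prop :=
  ∃ (r : ℕ) (e : Bool) (i k : ℕ → ℕ),
    1 ≤ r ∧
    (∀ d, 1 ≤ d → d < r → k (d + 1) < k d) ∧ m < k r ∧ k 1 ≤ n ∧
    (∀ d, 1 ≤ d → d < (if e then r else r - 1) → i d < i (d + 1)) ∧
    i (if e then r else r - 1) ≤ m ∧ 1 < i 1 ∧
    S = {v : Fin n × Fin n |
      (v.1.val + 1 = 1 ∧ v.2.val + 1 = k 1) ∨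
      (∃ d, 1 ≤ d ∧ d ≤ r - 1 ∧ v.1.val + 1 = i d ∧ v.2.val + 1 = k d) ∨
      (∃ d, 1 ≤ d ∧ d ≤ r - 1 ∧ v.1.val + 1 = i d ∧ v.2.val + 1 = k (d + 1)) ∨
      (e = true ∧ v.1.val + 1 = i r ∧ v.2.val + 1 = k r)}

/-- `λ ∈ 𝔫_(m)^*` is a path supercharacter representative. -/
def IsPathCharRep (m : ℕ) (A : Mat n F) : Prop :=
  AtMostOneBig A ∧
    ∀ p : Fin n × Fin n, A p.1 p.2 ≠ 0 → 1 < (compOf A p).ncard →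
      PathCharComp m (compOf A p)

end Reps

section ColumnDefs

variable {n : ℕ} {F : Type*} [Field F] [Fintype F]

/-- `u[k]`: the unipotent matrix agreeing with `u` in column `k` (off the diagonal) and equal
to the identity elsewhere. -/
noncomputable def uCol (u : Mat n F) (k : Fin n) : Mat n F :=
  1 + Matrix.of fun i j => if j = k then (u - 1) i j else 0

/-- `λ[u,k]`: the functional agreeing with `λ` at positions `(i,l)` with `l ≥ k` such that
`u_{jk} ≠ 0` for some `i ≤ j < k`, and vanishing elsewhere. -/
noncomputable def lamUK (lam u : Mat n F) (k : Fin n) : Mat n F :=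
  Matrix.of fun i l =>
    if k ≤ l ∧ ∃ j : Fin n, i ≤ j ∧ j < k ∧ u j k ≠ 0 then lam i l else 0

end ColumnDefs

section PatternGroup

variable {n : ℕ} {F : Type*} [Field F] {P : Fin n → Fin n → Prop}

theorem one_mem_patGroup : (1 : Mat n F) ∈ patGroup P :=
  ⟨fun i => by simp, fun i j hij _ => by simp [hij]⟩

theorem mul_mem_patGroup (hlt : ∀ i j, P i j → i < j)
    (htr : ∀ i j k, P i j → P j k → P i k) {a b : Mat n F}
    (ha : a ∈ patGroup P) (hb : b ∈ patGroup P) : a * b ∈ patGroup P := by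
  refine ⟨fun i => ?_, fun i j hij hP => ?_⟩
  · rw [Matrix.mul_apply, Finset.sum_eq_single i]
    · rw [ha.1, hb.1, one_mul]
    · intro l _ hl
      by_cases h1 : P i l
      · rw [hb.2 l i hl (fun h => lt_asymm (hlt _ _ h1) (hlt _ _ h)), mul_zero]
      · rw [ha.2 i l hl.symm h1, zero_mul]
    · simp
  · rw [Matrix.mul_apply]
    refine Finset.sum_eq_zero fun l _ => ?_
    by_cases hil : i = l
    · subst hil
      rw [hb.2 i j hij hP, mul_zero]
    by_cases h1 : P i l
    · by_cases hlj : l = j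
      · exact absurd (hlj ▸ h1) hP
      · rw [hb.2 l j hlj (fun h => hP (htr _ _ _ h1 h)), mul_zero]
    · rw [ha.2 i l hil h1, zero_mul]

theorem isUnit_det_of_mem_patGroup (hlt : ∀ i j, P i j → i < j) {a : Mat n F}
    (ha : a ∈ patGroup P) : IsUnit a.det := by
  have h : a.BlockTriangular id := fun i j hji =>
    ha.2 i j (ne_of_gt hji) (fun h => lt_asymm hji (hlt _ _ h))
  rw [Matrix.det_of_isUpperTriangular h]
  simp [ha.1]

theorem inv_mem_patGroup [Finite F] (hlt : ∀ i j, P i j → i < j)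
    (htr : ∀ i j k, P i j → P j k → P i k) {a : Mat n F}
    (ha : a ∈ patGroup P) : a⁻¹ ∈ patGroup P := by
  have hdet := isUnit_det_of_mem_patGroup hlt ha
  let f : ↥(patGroup P : Set (Mat n F)) → ↥(patGroup P : Set (Mat n F)) :=
    fun b => ⟨a * b.1, mul_mem_patGroup hlt htr ha b.2⟩
  have hf : Function.Injective f := by
    intro b c h
    have h' : a * b.1 = a * c.1 := congrArg Subtype.val h
    have h2 := congrArg (fun z => a⁻¹ * z) h'
    simp only [Matrix.nonsing_inv_mul_cancel_left _ _ hdet] at h2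
    exact Subtype.ext h2
  obtain ⟨b, hb⟩ := Finite.surjective_of_injective hf ⟨1, one_mem_patGroup⟩
  have hb' : a * b.1 = 1 := congrArg Subtype.val hb
  rw [Matrix.inv_eq_right_inv hb']
  exact b.2

/-- Truncation to `P` absorbs an inner truncation under the two-sided action of `U_P`. -/
theorem truncP_mul_truncP_mul (htr : ∀ i j k, P i j → P j k → P i k) {a b : Mat n F}
    (ha : a ∈ patGroup P) (hb : b ∈ patGroup P) (A : Mat n F) :
    truncP P (aᵀ * truncP P A * bᵀ) = truncP P (aᵀ * A * bᵀ) := by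
  ext i j
  simp only [truncP, Matrix.of_apply]
  split_ifs with hP
  · simp only [Matrix.mul_apply, Matrix.transpose_apply, Matrix.of_apply]
    refine Finset.sum_congr rfl fun l _ => ?_
    by_cases hl : j = l ∨ P j l
    · congr 1
      refine Finset.sum_congr rfl fun k _ => ?_
      by_cases hk : k = i ∨ P k i
      · have h1 : P k j := by
          rcases hk with rfl | hk
          · exact hP
          · exact htr _ _ _ hk hP
        have h2 : P k l := by
          rcases hl with rfl | hl
          · exact h1
          · exact htr _ _ _ h1 hl
        rw [if_pos h2]
      · push Not at hk
        rw [ha.2 k i hk.1 hk.2, zero_mul, zero_mul]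
    · push Not at hl
      rw [hb.2 j l hl.1 hl.2, mul_zero, mul_zero]
  · rfl

theorem pairM_eq_trace (A B : Mat n F) : pairM A B = (Aᵀ * B).trace := by
  simp only [pairM, Matrix.trace, Matrix.diag, Matrix.mul_apply, Matrix.transpose_apply]
  exact Finset.sum_comm

theorem pairM_mul_mul (a b A x : Mat n F) :
    pairM (aᵀ * A * bᵀ) x = pairM A (a * x * b) := by
  rw [pairM_eq_trace, pairM_eq_trace, Matrix.transpose_mul, Matrix.transpose_mul,
    Matrix.transpose_transpose, Matrix.transpose_transpose, Matrix.mul_assoc, Matrix.trace_mul_comm]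
  simp only [Matrix.mul_assoc]

theorem pairM_truncP {x : Mat n F} (hx : ∀ i j, ¬ P i j → x i j = 0) (A : Mat n F) :
    pairM (truncP P A) x = pairM A x := by
  simp only [pairM, truncP, Matrix.of_apply]
  refine Finset.sum_congr rfl fun i _ => Finset.sum_congr rfl fun j _ => ?_
  split_ifs with h
  · rfl
  · rw [hx i j h, mul_zero, mul_zero]

variable [Fintype F]

/-- The elements of `U_P × U_P`, as a finset. -/
noncomputable def patPairs (F : Type*) [Field F] [Fintype F] (P : Fin n → Fin n → Prop) :
    Finset (Mat n F × Mat n F) :=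
  Finset.univ.filter fun p => p.1 ∈ patGroup P ∧ p.2 ∈ patGroup P

theorem mem_patPairs {p : Mat n F × Mat n F} :
    p ∈ patPairs F P ↔ p.1 ∈ patGroup P ∧ p.2 ∈ patGroup P := by
  simp [patPairs]

theorem card_patPairs_ne_zero : ((patPairs F P).card : ℂ) ≠ 0 := by
  rw [Nat.cast_ne_zero]
  exact Finset.card_ne_zero_of_mem ((mem_patPairs (p := (1, 1))).2 ⟨one_mem_patGroup, one_mem_patGroup⟩)

theorem card_patPairs_fiber (hlt : ∀ i j, P i j → i < j)
    (htr : ∀ i j k, P i j → P j k → P i k) (lam : Mat n F)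
    {p : Mat n F × Mat n F} (hp : p ∈ patPairs F P) :
    ((patPairs F P).filter fun q =>
        truncP P (q.1ᵀ * lam * q.2ᵀ) = truncP P (p.1ᵀ * lam * p.2ᵀ)).card =
      ((patPairs F P).filter fun q => truncP P (q.1ᵀ * lam * q.2ᵀ) = truncP P lam).card := by
  obtain ⟨ha, hb⟩ := mem_patPairs.1 hp
  have ha' := inv_mem_patGroup hlt htr ha
  have hb' := inv_mem_patGroup hlt htr hb
  have hda := isUnit_det_of_mem_patGroup hlt ha
  have hdb := isUnit_det_of_mem_patGroup hlt hb
  have key : ∀ (c d : Mat n F), c ∈ patGroup P → d ∈ patGroup P → ∀ A B : Mat n F,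
      truncP P A = truncP P B → truncP P (cᵀ * A * dᵀ) = truncP P (cᵀ * B * dᵀ) := by
    intro c d hc hd A B h
    rw [← truncP_mul_truncP_mul htr hc hd A, h, truncP_mul_truncP_mul htr hc hd B]
  refine Finset.card_nbij' (fun q => (q.1 * p.1⁻¹, p.2⁻¹ * q.2))
    (fun q => (q.1 * p.1, p.2 * q.2)) ?_ ?_ ?_ ?_
  · intro q hq
    simp only [Finset.coe_filter, Set.mem_ofPred_eq, mem_patPairs] at hq ⊢
    obtain ⟨⟨h1, h2⟩, h3⟩ := hq
    refine ⟨⟨mul_mem_patGroup hlt htr h1 ha', mul_mem_patGroup hlt htr hb' h2⟩, ?_⟩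
    have h4 := key _ _ ha' hb' _ _ h3
    have e1 : (p.1⁻¹)ᵀ * p.1ᵀ = 1 := by
      rw [← Matrix.transpose_mul, Matrix.mul_nonsing_inv _ hda, Matrix.transpose_one]
    have e2 : p.2ᵀ * (p.2⁻¹)ᵀ = 1 := by
      rw [← Matrix.transpose_mul, Matrix.nonsing_inv_mul _ hdb, Matrix.transpose_one]
    have e3 : (p.1⁻¹)ᵀ * (p.1ᵀ * lam * p.2ᵀ) * (p.2⁻¹)ᵀ = lam := by
      calc _ = ((p.1⁻¹)ᵀ * p.1ᵀ) * lam * (p.2ᵀ * (p.2⁻¹)ᵀ) := by simp only [Matrix.mul_assoc]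
        _ = lam := by rw [e1, e2, Matrix.one_mul, Matrix.mul_one]
    rw [e3] at h4
    rw [← h4, Matrix.transpose_mul, Matrix.transpose_mul]
    simp only [Matrix.mul_assoc]
  · intro q hq
    simp only [Finset.coe_filter, Set.mem_ofPred_eq, mem_patPairs] at hq ⊢
    obtain ⟨⟨h1, h2⟩, h3⟩ := hq
    refine ⟨⟨mul_mem_patGroup hlt htr h1 ha, mul_mem_patGroup hlt htr hb h2⟩, ?_⟩
    rw [← key _ _ ha hb _ _ h3, Matrix.transpose_mul, Matrix.transpose_mul]
    simp only [Matrix.mul_assoc]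
  · intro q _
    simp [Matrix.nonsing_inv_mul_cancel_right _ _ hda, Matrix.mul_nonsing_inv_cancel_left _ _ hdb]
  · intro q _
    simp [Matrix.mul_nonsing_inv_cancel_right _ _ hda, Matrix.nonsing_inv_mul_cancel_left _ _ hdb]

theorem dualOrbit_eq_image (hlt : ∀ i j, P i j → i < j)
    (htr : ∀ i j k, P i j → P j k → P i k) (lam : Mat n F) :
    dualOrbit P lam =
      ((patPairs F P).image fun q => truncP P (q.1ᵀ * lam * q.2ᵀ) : Finset (Mat n F)) := by
  ext mu
  simp only [dualOrbit, Set.mem_ofPred_eq, Finset.coe_image, Set.mem_image, Finset.mem_coe,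
    mem_patPairs]
  constructor
  · rintro ⟨a, ha, b, hb, rfl⟩
    exact ⟨(a⁻¹, b⁻¹), ⟨inv_mem_patGroup hlt htr ha, inv_mem_patGroup hlt htr hb⟩, rfl⟩
  · rintro ⟨⟨a, b⟩, ⟨ha, hb⟩, rfl⟩
    refine ⟨a⁻¹, inv_mem_patGroup hlt htr ha, b⁻¹, inv_mem_patGroup hlt htr hb, ?_⟩
    rw [Matrix.nonsing_inv_nonsing_inv _ (isUnit_det_of_mem_patGroup hlt ha),
      Matrix.nonsing_inv_nonsing_inv _ (isUnit_det_of_mem_patGroup hlt hb)]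

/-- The average of `θ(-λ(a x b))` over `a, b ∈ U_P`. -/
noncomputable def orbitMean (P : Fin n → Fin n → Prop) (θ : AddChar F ℂ) (lam x : Mat n F) : ℂ :=
  (∑ p ∈ patPairs F P, θ (-pairM lam (p.1 * x * p.2))) / (patPairs F P).card

theorem orbitMean_zero (θ : AddChar F ℂ) (lam : Mat n F) : orbitMean P θ lam 0 = 1 := by
  have h0 := card_patPairs_ne_zero (F := F) (P := P)
  simp only [orbitMean, pairM, Matrix.zero_mul, Matrix.zero_apply, mul_zero,
    Finset.sum_const_zero, neg_zero, AddChar.map_zero_eq_one, Finset.sum_const, nsmul_eq_mul,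
    mul_one]
  exact div_self h0

theorem superChar_eq_mul_orbitMean (hlt : ∀ i j, P i j → i < j)
    (htr : ∀ i j k, P i j → P j k → P i k) (θ : AddChar F ℂ) (lam : Mat n F) {u : Mat n F}
    (hu : u ∈ patGroup P) :
    superChar P θ lam u = (dualLeftOrbit P lam).ncard * orbitMean P θ lam (u - 1) := by
  have hx : ∀ i j, ¬ P i j → (u - 1) i j = 0 := by
    intro i j h
    by_cases hij : i = j
    · subst hij; simp [hu.1]
    · simp [hu.2 i j hij h, hij]
  set g : Mat n F × Mat n F → Mat n F := fun q => truncP P (q.1ᵀ * lam * q.2ᵀ) with hg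
  set c : ℕ := ((patPairs F P).filter fun q => g q = truncP P lam).card with hc
  have hfib : ∀ mu ∈ (patPairs F P).image g, ((patPairs F P).filter fun q => g q = mu).card = c := by
    intro mu hmu
    obtain ⟨p, hp, rfl⟩ := Finset.mem_image.1 hmu
    exact card_patPairs_fiber hlt htr lam hp
  have hcard : (patPairs F P).card = ((patPairs F P).image g).card * c := by
    rw [Finset.card_eq_sum_card_image g, Finset.sum_congr rfl hfib, Finset.sum_const, smul_eq_mul]
  have hsum : ∑ p ∈ patPairs F P, θ (-pairM lam (p.1 * (u - 1) * p.2)) =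
      c * ∑ mu ∈ (patPairs F P).image g, θ (-pairM mu (u - 1)) := by
    have h1 : ∀ p ∈ patPairs F P,
        θ (-pairM lam (p.1 * (u - 1) * p.2)) = θ (-pairM (g p) (u - 1)) := fun p _ => by
      rw [hg, pairM_truncP hx, pairM_mul_mul]
    rw [Finset.sum_congr rfl h1, Finset.sum_comp (fun mu => θ (-pairM mu (u - 1))) g,
      Finset.mul_sum]
    refine Finset.sum_congr rfl fun mu hmu => ?_
    rw [hfib mu hmu, nsmul_eq_mul]
  have h0 := card_patPairs_ne_zero (F := F) (P := P)
  rw [hcard, Nat.cast_mul] at h0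
  have hc0 := right_ne_zero_of_mul h0
  have hi0 := left_ne_zero_of_mul h0
  rw [superChar, orbitMean, dualOrbit_eq_image hlt htr, finsum_mem_coe_finset,
    Set.ncard_coe_finset, ← hg, hsum, hcard, Nat.cast_mul]
  field_simp

theorem dualLeftOrbit_ncard_ne_zero (lam : Mat n F) :
    ((dualLeftOrbit P lam).ncard : ℂ) ≠ 0 := by
  rw [Nat.cast_ne_zero]
  exact Set.ncard_ne_zero_of_mem (a := truncP P ((1⁻¹)ᵀ * lam)) ⟨1, one_mem_patGroup, rfl⟩

theorem superChar_one (hlt : ∀ i j, P i j → i < j)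
    (htr : ∀ i j k, P i j → P j k → P i k) (θ : AddChar F ℂ) (lam : Mat n F) :
    superChar P θ lam 1 = (dualLeftOrbit P lam).ncard := by
  rw [superChar_eq_mul_orbitMean hlt htr θ lam one_mem_patGroup, sub_self, orbitMean_zero, mul_one]

theorem superChar_div_superChar_one (hlt : ∀ i j, P i j → i < j)
    (htr : ∀ i j k, P i j → P j k → P i k) (θ : AddChar F ℂ) (lam : Mat n F) {u : Mat n F}
    (hu : u ∈ patGroup P) :
    superChar P θ lam u / superChar P θ lam 1 = orbitMean P θ lam (u - 1) := by
  rw [superChar_one hlt htr, superChar_eq_mul_orbitMean hlt htr θ lam hu,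
    mul_div_cancel_left₀ _ (dualLeftOrbit_ncard_ne_zero lam)]

end PatternGroup

/-- Two functions on a finite set are uncorrelated if points can be recombined so that one
function sees only the first argument and the other only the second. -/
theorem Finset.sum_mul_sum_eq_card_mul_sum_of_mix {α R : Type*} [CommSemiring R] (s : Finset α)
    (mix : α → α → α) (hmem : ∀ p ∈ s, ∀ q ∈ s, mix p q ∈ s)
    (hmix : ∀ p q, mix (mix p q) (mix q p) = p) (f g : α → R)
    (hf : ∀ p ∈ s, ∀ q ∈ s, f (mix p q) = f p) (hg : ∀ p ∈ s, ∀ q ∈ s, g (mix p q) = g q) :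
    (∑ p ∈ s, f p) * ∑ p ∈ s, g p = s.card * ∑ p ∈ s, f p * g p := by
  have h : ∑ z ∈ s ×ˢ s, f z.1 * g z.2 = ∑ z ∈ s ×ˢ s, f z.1 * g z.1 := by
    refine Finset.sum_nbij' (fun z => (mix z.1 z.2, mix z.2 z.1))
      (fun z => (mix z.1 z.2, mix z.2 z.1)) ?_ ?_ ?_ ?_ ?_
    · intro z hz
      rw [Finset.mem_product] at hz ⊢
      exact ⟨hmem _ hz.1 _ hz.2, hmem _ hz.2 _ hz.1⟩
    · intro z hz
      rw [Finset.mem_product] at hz ⊢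
      exact ⟨hmem _ hz.1 _ hz.2, hmem _ hz.2 _ hz.1⟩
    · intro z _
      exact Prod.ext (hmix _ _) (hmix _ _)
    · intro z _
      exact Prod.ext (hmix _ _) (hmix _ _)
    · intro z hz
      rw [Finset.mem_product] at hz
      rw [hf _ hz.1 _ hz.2, hg _ hz.1 _ hz.2]
  rw [Finset.sum_mul_sum, ← Finset.sum_product', h, Finset.sum_product' s s fun x _ => f x * g x]
  simp only [Finset.sum_const, nsmul_eq_mul, Finset.mul_sum]

section Columns

variable {n : ℕ} {F : Type*} [Field F]

/-- The matrix agreeing with `x` in column `k` and vanishing elsewhere. -/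
def colPart (x : Mat n F) (k : Fin n) : Mat n F :=
  Matrix.of fun i j => if j = k then x i j else 0

theorem mul_colPart_mul_apply (a x b : Mat n F) (k i l : Fin n) :
    (a * colPart x k * b) i l = (∑ j, a i j * x j k) * b k l := by
  rw [Matrix.mul_apply, Finset.sum_eq_single k]
  · simp [Matrix.mul_apply, colPart]
  · intro j _ hj
    simp [Matrix.mul_apply, colPart, hj]
  · simp

theorem pairM_sum {ι : Type*} (A : Mat n F) (T : Finset ι) (B : ι → Mat n F) :
    pairM A (∑ k ∈ T, B k) = ∑ k ∈ T, pairM A (B k) := by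
  simp only [pairM_eq_trace, Matrix.mul_sum, Matrix.trace_sum]

variable [Fintype F] {P : Fin n → Fin n → Prop}

/-- Independence of the columns of `x` whenever each row `j` containing two nonzero entries is
such that column `j` is constant on `U_P`. -/
theorem orbitMean_sum_colPart (θ : AddChar F ℂ) (lam x : Mat n F)
    (hx : ∀ j k k', x j k ≠ 0 → x j k' ≠ 0 → k = k' ∨ ∀ i, ¬ P i j) (T : Finset (Fin n)) :
    orbitMean P θ lam (∑ k ∈ T, colPart x k) = ∏ k ∈ T, orbitMean P θ lam (colPart x k) := by
  have hexp : ∀ (T : Finset (Fin n)) (p : Mat n F × Mat n F),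
      θ (-pairM lam (p.1 * (∑ k ∈ T, colPart x k) * p.2)) =
        ∏ k ∈ T, θ (-pairM lam (p.1 * colPart x k * p.2)) := by
    intro T p
    rw [Matrix.mul_sum, Matrix.sum_mul, pairM_sum, ← Finset.sum_neg_distrib]
    exact map_prod θ.toMonoidHom (fun k => Multiplicative.ofAdd _) T
  induction T using Finset.induction_on with
  | empty => simp [orbitMean_zero]
  | insert k T hk ih =>
    rw [Finset.prod_insert hk, ← ih]
    simp only [orbitMean, hexp, Finset.prod_insert hk]
    let mix : Mat n F × Mat n F → Mat n F × Mat n F → Mat n F × Mat n F := fun p q =>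
      (Matrix.of fun i j => if x j k ≠ 0 then p.1 i j else q.1 i j,
        Matrix.of fun i j => if i = k then p.2 i j else q.2 i j)
    have hcongr : ∀ (p q : Mat n F × Mat n F) (l : Fin n),
        (∀ i j, x j l ≠ 0 → p.1 i j = q.1 i j) → (∀ j, p.2 l j = q.2 l j) →
        p.1 * colPart x l * p.2 = q.1 * colPart x l * q.2 := by
      intro p q l h1 h2
      ext i j
      rw [mul_colPart_mul_apply, mul_colPart_mul_apply, h2]
      congr 1
      refine Finset.sum_congr rfl fun r _ => ?_
      by_cases hr : x r l = 0
      · rw [hr, mul_zero, mul_zero]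
      · rw [h1 i r hr]
    have hind := Finset.sum_mul_sum_eq_card_mul_sum_of_mix (patPairs F P) mix
      (fun p hp q hq => by
        rw [mem_patPairs] at hp hq ⊢
        obtain ⟨⟨p11, p12⟩, ⟨p21, p22⟩⟩ := hp
        obtain ⟨⟨q11, q12⟩, ⟨q21, q22⟩⟩ := hq
        refine ⟨⟨fun i => ?_, fun i j hij h => ?_⟩, ⟨fun i => ?_, fun i j hij h => ?_⟩⟩
        · simp [mix, p11, q11]
        · simp [mix, p12 i j hij h, q12 i j hij h]
        · simp [mix, p21, q21]
        · simp [mix, p22 i j hij h, q22 i j hij h])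
      (fun p q => by
        refine Prod.ext (Matrix.ext fun i j => ?_) (Matrix.ext fun i j => ?_)
        · simp only [mix, Matrix.of_apply]; split_ifs <;> rfl
        · simp only [mix, Matrix.of_apply]; split_ifs <;> rfl)
      (fun p => θ (-pairM lam (p.1 * colPart x k * p.2)))
      (fun p => ∏ l ∈ T, θ (-pairM lam (p.1 * colPart x l * p.2)))
      (fun p _ q _ => by
        rw [hcongr (mix p q) p k (fun i j h => by simp [mix, h]) (fun j => by simp [mix])])
      (fun p hp q hq => by
        refine Finset.prod_congr rfl fun l hl => ?_
        have hlk : l ≠ k := fun h => hk (h ▸ hl)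
        rw [hcongr (mix p q) q l ?_ (fun j => by simp [mix, hlk])]
        intro i j h
        simp only [mix, Matrix.of_apply]
        split_ifs with h'
        · have hj := (hx j l k h h').resolve_left hlk
          rw [mem_patPairs] at hp hq
          by_cases hij : i = j
          · rw [hij, hp.1.1, hq.1.1]
          · rw [hp.1.2 i j hij (hj i), hq.1.2 i j hij (hj i)]
        · rfl)
    have h0 := card_patPairs_ne_zero (F := F) (P := P)
    rw [div_mul_div_comm, hind]
    field_simp

/-- Entries of `λ` outside `λ[u,k]` do not contribute on column `k`. -/
theorem orbitMean_lamUK (hlt : ∀ i j, P i j → i < j) (θ : AddChar F ℂ) (lam : Mat n F)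
    {u : Mat n F} (hu : u ∈ patGroup P) (k : Fin n) :
    orbitMean P θ (lamUK lam u k) (colPart (u - 1) k) =
      orbitMean P θ lam (colPart (u - 1) k) := by
  rw [orbitMean, orbitMean]
  congr 1
  refine Finset.sum_congr rfl fun p hp => ?_
  obtain ⟨ha, hb⟩ := mem_patPairs.1 hp
  congr 2
  refine Finset.sum_congr rfl fun i _ => Finset.sum_congr rfl fun l _ => ?_
  simp only [lamUK, Matrix.of_apply]
  split_ifs with h
  · rfl
  rw [mul_colPart_mul_apply, zero_mul, eq_comm]
  by_cases hkl : k ≤ l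
  · rw [Finset.sum_eq_zero, zero_mul, mul_zero]
    intro j _
    by_cases hij : i ≤ j
    · have hz : (u - 1) j k = 0 := by
        by_cases hjk : j = k
        · subst hjk; simp [hu.1]
        · by_contra hne
          have hujk : u j k ≠ 0 := by simpa [hjk] using hne
          have hP : P j k := by
            by_contra hP
            exact hujk (hu.2 j k hjk hP)
          exact h ⟨hkl, j, hij, hlt _ _ hP, hujk⟩
      rw [hz, mul_zero]
    · push Not at hij
      rw [ha.2 i j hij.ne' (fun h => lt_asymm hij (hlt _ _ h)), zero_mul]
  · push Not at hkl
    rw [hb.2 k l hkl.ne' (fun h => lt_asymm hkl (hlt _ _ h)), mul_zero, mul_zero]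

end Columns

section CombRows

variable {n m : ℕ} {F : Type*} [Field F]

theorem Pm_lt (i j : Fin n) (h : Pm n m i j) : i < j := h.1

theorem Pm_trans (i j k : Fin n) (h : Pm n m i j) (h' : Pm n m j k) : Pm n m i k := by
  refine ⟨h.1.trans h'.1, fun hi => ?_⟩
  have h1 := h.2 hi
  have h2 : j.val < k.val := h'.1
  omega

/-- A comb superclass representative has at most one nonzero entry in each row but the first. -/
theorem IsCombClassRep.eq_of_ne_zero {A : Mat n F} (hA : IsCombClassRep m A) {j k k' : Fin n}
    (hj : j.val ≠ 0) (h : A j k ≠ 0) (h' : A j k' ≠ 0) : k = k' := by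
  by_contra hne
  have h1 : (j, k) ∈ compOf A (j, k) := Relation.ReflTransGen.refl
  have h2 : (j, k') ∈ compOf A (j, k) :=
    Relation.ReflTransGen.single ⟨by simpa using hne, h, h', Or.inl rfl⟩
  have hcard : 1 < (compOf A (j, k)).ncard :=
    (Set.one_lt_ncard_iff (Set.toFinite _)).2 ⟨_, _, h1, h2, by simpa using hne⟩
  obtain ⟨r, r', _, _, i, c, hi, _, _, _, _, _, hS⟩ := hA.2 (j, k) h hcard
  have hanti : ∀ d e, 1 ≤ d → d < e → e ≤ r' → i e < i d := by
    intro d e hd hde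
    induction e, hde using Nat.le_induction with
    | base => exact fun he => hi d hd he
    | succ e hde ih => exact fun he => (hi e (by omega) he).trans (ih (by omega))
  rw [hS] at h1 h2
  rcases h1 with ⟨h1, _⟩ | ⟨d, hd, hdr, hid, hkd⟩
  · exact hj (by simpa using h1)
  rcases h2 with ⟨h2, _⟩ | ⟨e, he, her, hie, hke⟩
  · exact hj (by simpa using h2)
  rcases lt_trichotomy d e with hde | rfl | hde
  · have := hanti d e hd hde her
    simp only at hid hie
    omega
  · exact hne (Fin.ext (by simp only at hkd hke; omega))
  · have := hanti e d he hde hdr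
    simp only at hid hie
    omega

end CombRows

/-- For a comb superclass representative `u ∈ U_(m)` and a comb supercharacter
representative `λ ∈ 𝔫_(m)^*`:
`χ^λ(u) = χ^λ(1) · ∏_{k=2}^{n} χ^{λ[u,k]}(u[k]) / χ^{λ[u,k]}(1)` (columns 1-based). -/
theorem stmt16 {n m : ℕ} (hm : 0 < m) (hmn : m < n) {F : Type*} [Field F] [Fintype F]
    (θ : AddChar F ℂ) (hθ : ∃ x, θ x ≠ 1)
    (u : Mat n F) (hu : u ∈ patGroup (Pm n m)) (hucomb : IsCombClassRep m (u - 1))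
    (lam : Mat n F) (hlam : ∀ i j : Fin n, ¬ Pm n m i j → lam i j = 0)
    (hlcomb : IsCombCharRep m lam) :
    superChar (Pm n m) θ lam u =
      superChar (Pm n m) θ lam 1 *
        ∏ k ∈ Finset.univ.filter (fun k : Fin n => 1 ≤ k.val),
          (superChar (Pm n m) θ (lamUK lam u k) (uCol u k) /
            superChar (Pm n m) θ (lamUK lam u k) 1) := by
  have hlt := Pm_lt (n := n) (m := m)
  have htr := Pm_trans (n := n) (m := m)
  set T : Finset (Fin n) := Finset.univ.filter (fun k : Fin n => 1 ≤ k.val) with hT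
  have hcol : ∀ k, uCol u k - 1 = colPart (u - 1) k := fun k => by
    simp [uCol, colPart]
  have hmem : ∀ k, uCol u k ∈ patGroup (Pm n m) := fun k => by
    refine ⟨fun i => ?_, fun i j hij hP => ?_⟩
    · simp [uCol, hu.1]
    · simp [uCol, hij, hu.2 i j hij hP]
  have hsum : ∑ k ∈ T, colPart (u - 1) k = u - 1 := by
    ext i j
    rw [Matrix.sum_apply]
    simp only [colPart, Matrix.of_apply, Finset.sum_ite_eq]
    split_ifs with hj
    · rfl
    · have hj0 : j.val = 0 := by simpa [hT] using hj
      by_cases hij : i = j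
      · subst hij; simp [hu.1]
      · have hP : ¬ Pm n m i j := fun h => by
          have : i.val < j.val := h.1
          omega
        simp [hu.2 i j hij hP, hij]
  have hrow : ∀ j k k', (u - 1) j k ≠ 0 → (u - 1) j k' ≠ 0 → k = k' ∨ ∀ i, ¬ Pm n m i j := by
    intro j k k' h h'
    by_cases hj : j.val = 0
    · refine Or.inr fun i hi => ?_
      have : i.val < j.val := hi.1
      omega
    · exact Or.inl (hucomb.eq_of_ne_zero hj h h')
  rw [superChar_eq_mul_orbitMean hlt htr θ lam hu, superChar_one hlt htr]
  congr 1
  conv_lhs => rw [← hsum]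
  rw [orbitMean_sum_colPart θ lam (u - 1) hrow T]
  refine Finset.prod_congr rfl fun k _ => ?_
  rw [superChar_div_superChar_one hlt htr θ _ (hmem k), hcol, orbitMean_lamUK hlt θ lam hu]
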